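/- Let M, N be transversal subspaces of ℝ^d (i.e. M + N = ℝ^d). Let (𝓜_t)_{t∈ℕ} and (𝓝_t)_{t∈ℕ} be sequences of collections of subspaces of ℝ^d that converge exponentially fast to M resp. N, in the sense that λ_M := λ(t ↦ sup_{M'∈𝓜_t} d(M',M)) < 0 and λ_N := λ(t ↦ sup_{N'∈𝓝_t} d(N',N)) < 0. Then the extended Lyapunov index of (t₁,t₂) ↦ sup_{M'∈𝓜_{t₁}} sup_{N'∈𝓝_{t₂}} d(M'∩N', M∩N) is at most max(λ_M, λ_N). -/

import Mathlib

open MeasureTheory Filter Submodule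
open scoped RealInnerProductSpace

/-- Logarithm on `ℝ≥0` with values in `EReal`, with `log 0 = ⊥`. -/
noncomputable def elog (x : NNReal) : EReal :=
  if x = 0 then ⊥ else ((Real.log (x : ℝ) : ℝ) : EReal)

/-- The Lyapunov index `λ(f) = limsup_{t→∞} (1/t) log f(t)` of `f : ℕ → ℝ≥0`,
with values in `ℝ ∪ {±∞}`. -/
noncomputable def lyapIndex (f : ℕ → NNReal) : EReal :=
  Filter.atTop.limsup fun t : ℕ => (((t : ℝ)⁻¹ : ℝ) : EReal) * elog (f t)

/-- The extended Lyapunov index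
`λ̄(g) = limsup_{T→∞} sup_{t₁,t₂ ≥ T} (1/min(t₁,t₂)) log g(t₁,t₂)`. -/
noncomputable def extLyapIndex (g : ℕ → ℕ → NNReal) : EReal :=
  Filter.atTop.limsup fun T : ℕ =>
    ⨆ t₁ ∈ Set.Ici T, ⨆ t₂ ∈ Set.Ici T,
      ((((min t₁ t₂ : ℕ) : ℝ)⁻¹ : ℝ) : EReal) * elog (g t₁ t₂)

abbrev Euc (d : ℕ) := EuclideanSpace ℝ (Fin d)

/-- The orthogonal projection of `ℝ^d` onto the subspace `M`, as a map `ℝ^d →L ℝ^d`. -/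
noncomputable def projL {d : ℕ} (M : Submodule ℝ (Euc d)) : Euc d →L[ℝ] Euc d :=
  M.subtypeL.comp (orthogonalProjection M)

/-- The distance `d(M,N) = ‖P_M − P_N‖` between subspaces of `ℝ^d`. -/
noncomputable def subDist {d : ℕ} (M N : Submodule ℝ (Euc d)) : ℝ :=
  ‖projL M - projL N‖

section Projections

variable {E : Type*} [NormedAddCommGroup E] [InnerProductSpace ℝ E] [FiniteDimensional ℝ E]

theorem norm_sub_starProjection_le_of_mem {A B : Submodule ℝ E} {x : E} (hx : x ∈ A) :
    ‖x - B.starProjection x‖ ≤ ‖A.starProjection - B.starProjection‖ * ‖x‖ := by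
  have h := (A.starProjection - B.starProjection).le_opNorm x
  rwa [sub_apply, starProjection_eq_self_iff.2 hx] at h

/-- The distance between two subspaces is controlled by their one-sided gaps. -/
theorem norm_starProjection_sub_le {A B : Submodule ℝ E} {a b : ℝ} (ha : 0 ≤ a) (hb : 0 ≤ b)
    (hA : ∀ x ∈ A, ‖x - B.starProjection x‖ ≤ a * ‖x‖)
    (hB : ∀ x ∈ B, ‖x - A.starProjection x‖ ≤ b * ‖x‖) :
    ‖A.starProjection - B.starProjection‖ ≤ a + b := by
  have gap : ∀ {A B : Submodule ℝ E} {c : ℝ}, 0 ≤ c →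
      (∀ x ∈ A, ‖x - B.starProjection x‖ ≤ c * ‖x‖) →
      ‖(1 - B.starProjection) * A.starProjection‖ ≤ c := by
    intro A B c hc h
    refine ContinuousLinearMap.opNorm_le_bound _ hc fun x => ?_
    refine (h _ (A.starProjection_apply_mem x)).trans ?_
    gcongr
    exact A.norm_starProjection_apply_le x
  have hA' := gap ha hA
  have hB' := gap hb hB
  rw [← norm_star, star_mul, star_sub, star_one, (isSelfAdjoint_starProjection A).star_eq,
    (isSelfAdjoint_starProjection B).star_eq] at hB'
  have key : A.starProjection - B.starProjection =
      (1 - B.starProjection) * A.starProjection - B.starProjection * (1 - A.starProjection) := by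
    noncomm_ring
  rw [key]
  exact (norm_sub_le _ _).trans (add_le_add hA' hB')

theorem norm_starProjection_orthogonal_sub (A B : Submodule ℝ E) :
    ‖Aᗮ.starProjection - Bᗮ.starProjection‖ = ‖A.starProjection - B.starProjection‖ := by
  rw [starProjection_orthogonal, starProjection_orthogonal, sub_sub_sub_cancel_left,
    norm_sub_rev]

theorem exists_pos_mul_add_norm_le {U V : Submodule ℝ E} (h : Disjoint U V) :
    ∃ κ : ℝ, 0 < κ ∧ ∀ u ∈ U, ∀ v ∈ V, κ * (‖u‖ + ‖v‖) ≤ ‖u + v‖ := by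
  let f : U × V →ₗ[ℝ] E := U.subtype.coprod V.subtype
  have hf : LinearMap.ker f = ⊥ := by
    rw [LinearMap.ker_eq_bot']
    rintro ⟨u, v⟩ huv
    have huv : (u : E) + v = 0 := huv
    have hu : (u : E) = -v := eq_neg_of_add_eq_zero_left huv
    have hu0 : (u : E) = 0 :=
      Submodule.disjoint_def.1 h u u.2 (hu ▸ V.neg_mem v.2)
    have hv0 : (v : E) = 0 := by simpa [hu0] using huv
    ext <;> simp [hu0, hv0]
  obtain ⟨K, hK, hanti⟩ := f.exists_antilipschitzWith hf
  refine ⟨(2 * K)⁻¹, by positivity, fun u hu v hv => ?_⟩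
  have h1 : ‖((⟨u, hu⟩, ⟨v, hv⟩) : U × V)‖ ≤ K * ‖u + v‖ := by
    exact ZeroHomClass.bound_of_antilipschitz f hanti (⟨u, hu⟩, ⟨v, hv⟩)
  have h2 : ‖u‖ ≤ K * ‖u + v‖ := (norm_fst_le _).trans h1
  have h3 : ‖v‖ ≤ K * ‖u + v‖ := (norm_snd_le _).trans h1
  rw [inv_mul_le_iff₀ (by positivity)]
  linarith

theorem norm_sub_starProjection_sup_le {U V U' V' : Submodule ℝ E} {κ ε : ℝ} (hκ : 0 < κ)
    (hUV : ∀ u ∈ U, ∀ v ∈ V, κ * (‖u‖ + ‖v‖) ≤ ‖u + v‖) (hε : 0 ≤ ε)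
    (hU : ‖U.starProjection - U'.starProjection‖ ≤ ε)
    (hV : ‖V.starProjection - V'.starProjection‖ ≤ ε) {x : E} (hx : x ∈ U ⊔ V) :
    ‖x - (U' ⊔ V').starProjection x‖ ≤ ε / κ * ‖x‖ := by
  obtain ⟨u, hu, v, hv, rfl⟩ := Submodule.mem_sup.1 hx
  have hmem : U'.starProjection u + V'.starProjection v ∈ U' ⊔ V' :=
    Submodule.add_mem_sup (starProjection_apply_mem _ _) (starProjection_apply_mem _ _)
  calc ‖u + v - (U' ⊔ V').starProjection (u + v)‖
      ≤ ‖u + v - (U'.starProjection u + V'.starProjection v)‖ := by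
        rw [starProjection_minimal]
        exact ciInf_le ⟨0, by rintro _ ⟨y, rfl⟩; positivity⟩
          (⟨_, hmem⟩ : (U' ⊔ V' : Submodule ℝ E))
    _ ≤ ‖u - U'.starProjection u‖ + ‖v - V'.starProjection v‖ := by
        rw [add_sub_add_comm]; exact norm_add_le _ _
    _ ≤ ε * ‖u‖ + ε * ‖v‖ := by
        gcongr
        · exact (norm_sub_starProjection_le_of_mem hu).trans (by gcongr)
        · exact (norm_sub_starProjection_le_of_mem hv).trans (by gcongr)
    _ = ε / κ * (κ * (‖u‖ + ‖v‖)) := by field_simp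
    _ ≤ ε / κ * ‖u + v‖ := by gcongr; exact hUV u hu v hv

theorem half_mul_add_norm_le_of_close {U V U' V' : Submodule ℝ E} {κ ε : ℝ} (hκ : 0 < κ)
    (hUV : ∀ u ∈ U, ∀ v ∈ V, κ * (‖u‖ + ‖v‖) ≤ ‖u + v‖) (hε : ε * (1 + κ) ≤ κ / 2)
    (hU : ‖U'.starProjection - U.starProjection‖ ≤ ε)
    (hV : ‖V'.starProjection - V.starProjection‖ ≤ ε) :
    ∀ u ∈ U', ∀ v ∈ V', κ / 2 * (‖u‖ + ‖v‖) ≤ ‖u + v‖ := by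
  intro u hu v hv
  have hu1 : ‖u - U.starProjection u‖ ≤ ε * ‖u‖ :=
    (norm_sub_starProjection_le_of_mem hu).trans (by gcongr)
  have hv1 : ‖v - V.starProjection v‖ ≤ ε * ‖v‖ :=
    (norm_sub_starProjection_le_of_mem hv).trans (by gcongr)
  have hu2 := norm_sub_norm_le u (U.starProjection u)
  have hv2 := norm_sub_norm_le v (V.starProjection v)
  have h1 := hUV _ (U.starProjection_apply_mem u) _ (V.starProjection_apply_mem v)
  have h2 : ‖U.starProjection u + V.starProjection v‖ - ‖u + v‖ ≤
      ‖u - U.starProjection u‖ + ‖v - V.starProjection v‖ := by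
    refine (norm_sub_norm_le _ _).trans ?_
    rw [norm_sub_rev, add_sub_add_comm]
    exact norm_add_le _ _
  have h3 : κ * ((1 - ε) * (‖u‖ + ‖v‖)) ≤
      κ * (‖U.starProjection u‖ + ‖V.starProjection v‖) := by
    gcongr; linarith
  have h4 := mul_le_mul_of_nonneg_right hε (by positivity : 0 ≤ ‖u‖ + ‖v‖)
  linarith

/-- Summation of subspaces is locally Lipschitz at a pair of independent subspaces. -/
theorem exists_norm_starProjection_sup_sub_le {U V : Submodule ℝ E} (h : Disjoint U V) :
    ∃ δ C : ℝ, 0 < δ ∧ 0 < C ∧ ∀ (U' V' : Submodule ℝ E) (ε : ℝ), ε ≤ δ →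
      ‖U'.starProjection - U.starProjection‖ ≤ ε →
      ‖V'.starProjection - V.starProjection‖ ≤ ε →
      ‖(U' ⊔ V').starProjection - (U ⊔ V).starProjection‖ ≤ C * ε := by
  obtain ⟨κ, hκ, hUV⟩ := exists_pos_mul_add_norm_le h
  refine ⟨κ / 2 / (1 + κ), 3 / κ, by positivity, by positivity, fun U' V' ε hε hU hV => ?_⟩
  have hε0 : 0 ≤ ε := (norm_nonneg _).trans hU
  have hUV' := half_mul_add_norm_le_of_close hκ hUV ((le_div_iff₀ (by positivity)).1 hε) hU hV
  refine (norm_starProjection_sub_le (a := ε / (κ / 2)) (b := ε / κ) (by positivity)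
    (by positivity)
    (fun x hx => norm_sub_starProjection_sup_le (by positivity) hUV' hε0 hU hV hx)
    (fun x hx => norm_sub_starProjection_sup_le hκ hUV hε0 (by rwa [norm_sub_rev])
      (by rwa [norm_sub_rev]) hx)).trans_eq ?_
  field_simp
  norm_num

/-- Intersection of subspaces is locally Lipschitz at a transversal pair. -/
theorem exists_norm_starProjection_inf_sub_le {M N : Submodule ℝ E} (h : M ⊔ N = ⊤) :
    ∃ δ C : ℝ, 0 < δ ∧ 0 < C ∧ ∀ (M' N' : Submodule ℝ E) (ε : ℝ), ε ≤ δ →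
      ‖M'.starProjection - M.starProjection‖ ≤ ε →
      ‖N'.starProjection - N.starProjection‖ ≤ ε →
      ‖(M' ⊓ N').starProjection - (M ⊓ N).starProjection‖ ≤ C * ε := by
  have hdisj : Disjoint Mᗮ Nᗮ := by
    rw [disjoint_iff, inf_orthogonal, h, top_orthogonal_eq_bot]
  obtain ⟨δ, C, hδ, hC, H⟩ := exists_norm_starProjection_sup_sub_le hdisj
  have hinf : ∀ A B : Submodule ℝ E, A ⊓ B = (Aᗮ ⊔ Bᗮ)ᗮ := fun A B => by
    rw [← inf_orthogonal, orthogonal_orthogonal, orthogonal_orthogonal]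
  refine ⟨δ, C, hδ, hC, fun M' N' ε hε hM hN => ?_⟩
  simp only [hinf M' N', hinf M N]
  rw [norm_starProjection_orthogonal_sub]
  exact H M'ᗮ N'ᗮ ε hε (by rwa [norm_starProjection_orthogonal_sub])
    (by rwa [norm_starProjection_orthogonal_sub])

end Projections

theorem subDist_eq {d : ℕ} (M N : Submodule ℝ (Euc d)) :
    subDist M N = ‖M.starProjection - N.starProjection‖ := rfl

theorem subDist_nonneg {d : ℕ} (M N : Submodule ℝ (Euc d)) : 0 ≤ subDist M N := norm_nonneg _

theorem subDist_le_two {d : ℕ} (M N : Submodule ℝ (Euc d)) : subDist M N ≤ 2 := by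
  rw [subDist_eq]
  linarith [norm_sub_le M.starProjection N.starProjection, M.starProjection_norm_le,
    N.starProjection_norm_le]

theorem subDist_le_biSup {d : ℕ} {S : Set (Submodule ℝ (Euc d))} {M' : Submodule ℝ (Euc d)}
    (hM' : M' ∈ S) (M : Submodule ℝ (Euc d)) :
    subDist M' M ≤ (⨆ A ∈ S, subDist A M).toNNReal := by
  refine le_trans ?_ (Real.le_coe_toNNReal _)
  refine le_ciSup_of_le ⟨2, ?_⟩ M' ?_
  · rintro _ ⟨A, rfl⟩
    exact Real.iSup_le (fun _ => subDist_le_two A M) zero_le_two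
  · exact le_ciSup_of_le ⟨2, by rintro _ ⟨_, rfl⟩; exact subDist_le_two M' M⟩ hM' le_rfl

theorem inv_mul_elog_le_iff {n : ℕ} (hn : 0 < n) {x : NNReal} {c : ℝ} :
    (((n : ℝ)⁻¹ : ℝ) : EReal) * elog x ≤ c ↔ (x : ℝ) ≤ Real.exp (c * n) := by
  have hn' : (0 : ℝ) < n := by exact_mod_cast hn
  rcases eq_or_ne x 0 with rfl | hx
  · simp [elog, EReal.coe_mul_bot_of_pos (inv_pos.2 hn'), (Real.exp_pos _).le]
  · have hx' : (0 : ℝ) < x := by positivity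
    rw [elog, if_neg hx, ← EReal.coe_mul, EReal.coe_le_coe_iff, inv_mul_le_iff₀ hn',
      ← Real.log_le_iff_le_exp hx', mul_comm]

theorem eventually_le_exp_of_lyapIndex_lt {f : ℕ → NNReal} {c : ℝ} (h : lyapIndex f < c) :
    ∀ᶠ t in atTop, (f t : ℝ) ≤ Real.exp (c * t) := by
  filter_upwards [eventually_lt_of_limsup_lt h, eventually_gt_atTop 0] with t ht h0
  exact (inv_mul_elog_le_iff h0).1 ht.le

theorem extLyapIndex_le_of_eventually_le {g : ℕ → ℕ → NNReal} {C c z : ℝ} (hC : 0 < C)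
    (hcz : c < z)
    (h : ∀ᶠ T in atTop, ∀ t₁ ≥ T, ∀ t₂ ≥ T,
      (g t₁ t₂ : ℝ) ≤ C * Real.exp (c * (min t₁ t₂ : ℕ))) :
    extLyapIndex g ≤ z := by
  refine limsup_le_of_le (by isBoundedDefault) ?_
  have hlarge : ∀ᶠ T : ℕ in atTop, Real.log C / (z - c) ≤ T :=
    tendsto_natCast_atTop_atTop.eventually_ge_atTop _
  filter_upwards [h, hlarge, eventually_gt_atTop 0] with T hT hTC hT0
  refine iSup₂_le fun t₁ ht₁ => iSup₂_le fun t₂ ht₂ => ?_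
  have hmin : T ≤ min t₁ t₂ := le_min ht₁ ht₂
  refine (inv_mul_elog_le_iff (hT0.trans_le hmin)).2 ((hT t₁ ht₁ t₂ ht₂).trans ?_)
  have hmin' : Real.log C / (z - c) ≤ (min t₁ t₂ : ℕ) := hTC.trans (by exact_mod_cast hmin)
  rw [div_le_iff₀ (sub_pos.2 hcz)] at hmin'
  rw [← Real.exp_log hC, ← Real.exp_add]
  exact Real.exp_le_exp.2 (by linarith)

/-- If the collections `𝓜_t`, `𝓝_t` of subspaces converge exponentially fast to the
transversal subspaces `M` resp. `N`, then the intersections converge to `M ∩ N` with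
extended Lyapunov index at most `max(λ_M, λ_N)`. -/
theorem extLyapIndex_inf_le_max (d : ℕ) (M N : Submodule ℝ (Euc d)) (htrans : M ⊔ N = ⊤)
    (𝓜 𝓝 : ℕ → Set (Submodule ℝ (Euc d)))
    (hM : lyapIndex (fun t => (⨆ M' ∈ 𝓜 t, subDist M' M).toNNReal) < 0)
    (hN : lyapIndex (fun t => (⨆ N' ∈ 𝓝 t, subDist N' N).toNNReal) < 0) :
    extLyapIndex (fun t₁ t₂ =>
        (⨆ M' ∈ 𝓜 t₁, ⨆ N' ∈ 𝓝 t₂, subDist (M' ⊓ N') (M ⊓ N)).toNNReal)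
      ≤ max (lyapIndex (fun t => (⨆ M' ∈ 𝓜 t, subDist M' M).toNNReal))
          (lyapIndex (fun t => (⨆ N' ∈ 𝓝 t, subDist N' N).toNNReal)) := by
  obtain ⟨δ, C, hδ, hC, H⟩ := exists_norm_starProjection_inf_sub_le htrans
  refine EReal.le_of_forall_lt_iff_le.1 fun z hz => ?_
  obtain ⟨c, hc, hcz⟩ := EReal.lt_iff_exists_real_btwn.1 (lt_min hz (max_lt hM hN))
  obtain ⟨hMc, hNc⟩ := max_lt_iff.1 hc
  obtain ⟨hcz, hc0⟩ := lt_min_iff.1 hcz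
  have hc0 : c < 0 := by exact_mod_cast hc0
  refine extLyapIndex_le_of_eventually_le hC (EReal.coe_lt_coe_iff.1 hcz) ?_
  have hsmall : ∀ᶠ t : ℕ in atTop, Real.exp (c * t) ≤ δ :=
    (Real.tendsto_exp_atBot.comp
      (tendsto_natCast_atTop_atTop.const_mul_atTop_of_neg hc0)).eventually_le_const hδ
  filter_upwards [eventually_forall_ge_atTop.2 (eventually_le_exp_of_lyapIndex_lt hMc),
    eventually_forall_ge_atTop.2 (eventually_le_exp_of_lyapIndex_lt hNc),
    eventually_forall_ge_atTop.2 hsmall] with T hMT hNT hδT t₁ ht₁ t₂ ht₂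
  have hpos : 0 ≤ C * Real.exp (c * (min t₁ t₂ : ℕ)) := by positivity
  have hmono : ∀ t ≥ min t₁ t₂, Real.exp (c * t) ≤ Real.exp (c * (min t₁ t₂ : ℕ)) :=
    fun t ht => Real.exp_le_exp.2 (mul_le_mul_of_nonpos_left (by exact_mod_cast ht) hc0.le)
  rw [Real.coe_toNNReal', max_le_iff]
  refine ⟨?_, hpos⟩
  refine Real.iSup_le (fun M' => Real.iSup_le (fun hM' => Real.iSup_le (fun N' =>
    Real.iSup_le (fun hN' => ?_) hpos) hpos) hpos) hpos
  exact H M' N' _ (hδT _ (le_min ht₁ ht₂))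
    (((subDist_le_biSup hM' M).trans (hMT t₁ ht₁)).trans (hmono _ (min_le_left _ _)))
    (((subDist_le_biSup hN' N).trans (hNT t₂ ht₂)).trans (hmono _ (min_le_right _ _)))
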